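/- arXiv:1705.10541 — 12 statements merged into one kernel-verified Lean document; each statement's English description precedes it below -/
import Mathlib

section
/- Let a : ℝ → ℝ be continuously differentiable with K := sup_{x ∈ [x_L,x_R]} |a'(x)| < ∞, and let u : ℝ × ℝ → ℝ be continuously differentiable on [0,∞) × [x_L, x_R] (with x_L < x_R) and satisfy ∂_t u(t,x) + ∂_x (a(x) u(t,x)) = 0 for all t ≥ 0 and x ∈ [x_L, x_R]. Then for every t ≥ 0, ∫_{x_L}^{x_R} u(t,x)² dx ≤ e^{t K} ( ∫_{x_L}^{x_R} u(0,x)² dx + ∫_0^t e^{−τ K} ( a(x_L) u(τ,x_L)² − a(x_R) u(τ,x_R)² ) dτ ). -/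
/-- energy estimate
`∫ u(t)² ≤ e^{tK} ( ∫ u(0)² + ∫₀ᵗ e^{−τK} (a(xL) u(τ,xL)² − a(xR) u(τ,xR)²) dτ )`
with `K = sup_{x ∈ [xL,xR]} |a'(x)|`. -/
theorem energy_estimate_advection
    (xL xR : ℝ) (hx : xL < xR)
    (a : ℝ → ℝ) (ha : ContDiff ℝ 1 a)
    (K : ℝ) (hK : K = sSup ((fun x => |deriv a x|) '' Set.Icc xL xR))
    (u : ℝ × ℝ → ℝ)
    (hu : ContDiffOn ℝ 1 u (Set.Ici (0 : ℝ) ×ˢ Set.Icc xL xR))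
    (hpde : ∀ t ≥ (0 : ℝ), ∀ x ∈ Set.Icc xL xR,
      deriv (fun s => u (s, x)) t + deriv (fun y => a y * u (t, y)) x = 0) :
    ∀ t ≥ (0 : ℝ),
      (∫ x in xL..xR, (u (t, x)) ^ 2) ≤
        Real.exp (t * K) *
          ((∫ x in xL..xR, (u (0, x)) ^ 2)
            + ∫ τ in (0 : ℝ)..t, Real.exp (-τ * K) *
                (a xL * (u (τ, xL)) ^ 2 - a xR * (u (τ, xR)) ^ 2)) := by
  classical
  intro T hT
  have hbound : ∀ x ∈ Set.Icc xL xR, |deriv a x| ≤ K := by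
    intro x hxm
    rw [hK]
    refine le_csSup ?_ ⟨x, hxm, rfl⟩
    exact (isCompact_Icc.image (ha.continuous_deriv le_rfl).abs).bddAbove
  set R : Set (ℝ × ℝ) := Set.Ioo (0:ℝ) T ×ˢ Set.Ioo xL xR with hR
  let f : ℝ × ℝ → ℝ := fun p => Real.exp (-p.1 * K) * (u p) ^ 2
  let g : ℝ × ℝ → ℝ := fun p => Real.exp (-p.1 * K) * (a p.2 * (u p) ^ 2)
  let h : ℝ × ℝ → ℝ := fun p => Real.exp (-p.1 * K) * ((-K - deriv a p.2) * (u p) ^ 2)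
  let f' : ℝ × ℝ → ℝ × ℝ →L[ℝ] ℝ := fun p =>
    if p ∈ R then fderiv ℝ f p else h p • ContinuousLinearMap.fst ℝ ℝ ℝ
  let g' : ℝ × ℝ → ℝ × ℝ →L[ℝ] ℝ := fun p => if p ∈ R then fderiv ℝ g p else 0
  have hsub : Set.Icc ((0:ℝ), xL) (T, xR) ⊆ Set.Ici (0 : ℝ) ×ˢ Set.Icc xL xR := by
    rintro ⟨s, y⟩ ⟨⟨h1, h2⟩, ⟨h3, h4⟩⟩
    exact ⟨h1, h2, h4⟩
  have huc : ContinuousOn u (Set.Icc ((0:ℝ), xL) (T, xR)) := hu.continuousOn.mono hsub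
  have hac : Continuous a := ha.continuous
  have hac' : Continuous (deriv a) := ha.continuous_deriv le_rfl
  have hud : ∀ p ∈ R, DifferentiableAt ℝ u p := by
    rintro ⟨s, y⟩ ⟨⟨h1, h2⟩, ⟨h3, h4⟩⟩
    refine (hu.contDiffAt ?_).differentiableAt one_ne_zero
    exact prod_mem_nhds (Ici_mem_nhds h1) (Icc_mem_nhds h3 h4)
  have had : Differentiable ℝ a := ha.differentiable one_ne_zero
  have hfd : ∀ p ∈ R, DifferentiableAt ℝ f p := by
    intro p hp
    have := hud p hp
    fun_prop
  have hgd : ∀ p ∈ R, DifferentiableAt ℝ g p := by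
    intro p hp
    have := hud p hp
    have h2 : DifferentiableAt ℝ (fun q : ℝ × ℝ => a q.2) p :=
      (had p.2).comp p differentiableAt_snd
    fun_prop
  have hfc : ContinuousOn f (Set.Icc ((0:ℝ), xL) (T, xR)) := by fun_prop
  have hgc : ContinuousOn g (Set.Icc ((0:ℝ), xL) (T, xR)) := by
    have h2 : Continuous (fun q : ℝ × ℝ => a q.2) := by fun_prop
    have := h2.continuousOn (s := Set.Icc ((0:ℝ), xL) (T, xR))
    fun_prop
  have hhc : ContinuousOn h (Set.Icc ((0:ℝ), xL) (T, xR)) := by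
    have h2 : Continuous (fun q : ℝ × ℝ => deriv a q.2) := by fun_prop
    have := h2.continuousOn (s := Set.Icc ((0:ℝ), xL) (T, xR))
    fun_prop
  have hline1 : ∀ (F : ℝ × ℝ → ℝ) (s y : ℝ), DifferentiableAt ℝ F (s, y) →
      HasDerivAt (fun r => F (r, y)) (fderiv ℝ F (s, y) (1, 0)) s := by
    intro F s y hF
    exact hF.hasFDerivAt.comp_hasDerivAt s ((hasDerivAt_id s).prodMk (hasDerivAt_const s y))
  have hline2 : ∀ (F : ℝ × ℝ → ℝ) (s y : ℝ), DifferentiableAt ℝ F (s, y) →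
      HasDerivAt (fun r => F (s, r)) (fderiv ℝ F (s, y) (0, 1)) y := by
    intro F s y hF
    exact hF.hasFDerivAt.comp_hasDerivAt y ((hasDerivAt_const y s).prodMk (hasDerivAt_id y))
  have hdiv : (fun p => f' p (1, 0) + g' p (0, 1)) = h := by
    funext p
    by_cases hp : p ∈ R
    · simp only [f', g', if_pos hp]
      have hu0 := hud p hp
      have hf0 := hfd p hp
      have hg0 := hgd p hp
      obtain ⟨s, y⟩ := p
      have hut := hline1 u s y hu0
      have hux := hline2 u s y hu0
      have hay := (had y).hasDerivAt
      have e1 : HasDerivAt (fun r => Real.exp (-r * K)) (Real.exp (-s * K) * (-1 * K)) s :=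
        (((hasDerivAt_id s).neg).mul_const K).exp
      have hF := (hline1 f s y hf0).unique (e1.mul (hut.pow 2))
      have hG := (hline2 g s y hg0).unique
        ((hay.mul (hux.pow 2)).const_mul (Real.exp (-s * K)))
      have hp1 := hpde s hp.1.1.le y ⟨hp.2.1.le, hp.2.2.le⟩
      have hm : deriv (fun y => a y * u (s, y)) y =
          deriv a y * u (s, y) + a y * fderiv ℝ u (s, y) (0, 1) := (hay.mul hux).deriv
      rw [hut.deriv, hm] at hp1
      rw [hF, hG]
      simp only [h]
      push_cast
      simp only [Pi.pow_apply]
      linear_combination (2 * Real.exp (-s * K) * u (s, y)) * hp1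
    · simp [f', g', if_neg hp]
  have key := MeasureTheory.integral_divergence_prod_Icc_of_hasFDerivAt_off_countable_of_le
    f g f' g' (0, xL) (T, xR) ⟨hT, hx.le⟩ ∅ Set.countable_empty hfc hgc
    (by
      rintro p ⟨hp, -⟩
      have hp' : p ∈ R := hp
      simp only [f', if_pos hp']
      exact (hfd p hp').hasFDerivAt)
    (by
      rintro p ⟨hp, -⟩
      have hp' : p ∈ R := hp
      simp only [g', if_pos hp']
      exact (hgd p hp').hasFDerivAt)
    (by
      rw [hdiv]
      exact hhc.integrableOn_compact isCompact_Icc)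
  have hneg : (∫ p in Set.Icc ((0:ℝ), xL) (T, xR), (f' p (1, 0) + g' p (0, 1))) ≤ 0 := by
    rw [hdiv]
    refine MeasureTheory.setIntegral_nonpos measurableSet_Icc ?_
    intro p hp
    have hb := neg_le_of_abs_le (hbound p.2 (hsub hp).2)
    refine mul_nonpos_of_nonneg_of_nonpos (Real.exp_pos _).le ?_
    exact mul_nonpos_of_nonpos_of_nonneg (by linarith) (sq_nonneg _)
  rw [key] at hneg
  simp only [f, g] at hneg
  have hint : ∀ y ∈ Set.Icc xL xR, IntervalIntegrable
      (fun τ => Real.exp (-τ * K) * (a y * u (τ, y) ^ 2)) MeasureTheory.volume 0 T := by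
    intro y hy
    apply ContinuousOn.intervalIntegrable
    rw [Set.uIcc_of_le hT]
    refine hgc.comp (f := fun τ : ℝ => (τ, y)) (by fun_prop) ?_
    intro τ hτ
    exact ⟨⟨hτ.1, hy.1⟩, ⟨hτ.2, hy.2⟩⟩
  have hsplit : (∫ τ in (0 : ℝ)..T, Real.exp (-τ * K) *
      (a xL * (u (τ, xL)) ^ 2 - a xR * (u (τ, xR)) ^ 2)) =
      (∫ τ in (0 : ℝ)..T, Real.exp (-τ * K) * (a xL * (u (τ, xL)) ^ 2)) -
      ∫ τ in (0 : ℝ)..T, Real.exp (-τ * K) * (a xR * (u (τ, xR)) ^ 2) := by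
    rw [← intervalIntegral.integral_sub (hint xL ⟨le_rfl, hx.le⟩) (hint xR ⟨hx.le, le_rfl⟩)]
    simp only [mul_sub]
  rw [hsplit]
  rw [intervalIntegral.integral_const_mul, intervalIntegral.integral_const_mul] at hneg
  simp only [neg_zero, zero_mul, Real.exp_zero, one_mul] at hneg
  have hexp : Real.exp (T * K) * Real.exp (-T * K) = 1 := by
    rw [← Real.exp_add]; simp
  calc (∫ x in xL..xR, (u (T, x)) ^ 2)
      = Real.exp (T * K) * (Real.exp (-T * K) * ∫ x in xL..xR, (u (T, x)) ^ 2) := by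
        rw [← mul_assoc, hexp, one_mul]
    _ ≤ _ := mul_le_mul_of_nonneg_left (by linarith) (Real.exp_pos _).le
end

section
/- Let a : ℝ → ℝ be continuously differentiable with a(x) > 0 on [x_L, x_R], and let u : ℝ × ℝ → ℝ be continuously differentiable on [0,∞) × [x_L, x_R] (with x_L < x_R) and satisfy ∂_t u(t,x) + ∂_x (a(x) u(t,x)) = 0 for all t ≥ 0 and x ∈ [x_L, x_R]. Then for every t ≥ 0, ∫_{x_L}^{x_R} a(x) u(t,x)² dx ≤ ∫_{x_L}^{x_R} a(x) u(0,x)² dx + ∫_0^t a(x_L)² u(τ,x_L)² dτ. -/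
/-- the `a`-weighted L² energy satisfies
`∫ a u(t)² ≤ ∫ a u(0)² + ∫₀ᵗ a(xL)² u(τ,xL)² dτ` for positive speed `a`. -/
theorem weighted_energy_estimate_advection
    (xL xR : ℝ) (hx : xL < xR)
    (a : ℝ → ℝ) (ha : ContDiff ℝ 1 a)
    (hapos : ∀ x ∈ Set.Icc xL xR, 0 < a x)
    (u : ℝ × ℝ → ℝ)
    (hu : ContDiffOn ℝ 1 u (Set.Ici (0 : ℝ) ×ˢ Set.Icc xL xR))
    (hpde : ∀ t ≥ (0 : ℝ), ∀ x ∈ Set.Icc xL xR,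
      deriv (fun s => u (s, x)) t + deriv (fun y => a y * u (t, y)) x = 0) :
    ∀ t ≥ (0 : ℝ),
      (∫ x in xL..xR, a x * (u (t, x)) ^ 2) ≤
        (∫ x in xL..xR, a x * (u (0, x)) ^ 2)
          + ∫ τ in (0 : ℝ)..t, (a xL) ^ 2 * (u (τ, xL)) ^ 2 := by
  intro t ht
  set D : Set (ℝ × ℝ) := Set.Icc 0 t ×ˢ Set.Icc xL xR with hD
  set O : Set (ℝ × ℝ) := Set.Ioo 0 t ×ˢ Set.Ioo xL xR with hO
  have hac : Continuous a := ha.continuous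
  have had : Differentiable ℝ a := ha.differentiable (by norm_num)
  have huc : ContinuousOn u D := hu.continuousOn.mono (by
    rintro ⟨s, x⟩ ⟨hs, hx'⟩
    exact ⟨hs.1, hx'⟩)
  have hud : ∀ p ∈ O, DifferentiableAt ℝ u p := by
    rintro ⟨s, x⟩ ⟨hs, hx'⟩
    refine (hu.differentiableOn (by norm_num)).differentiableAt ?_
    exact prod_mem_nhds (Ici_mem_nhds hs.1) (Icc_mem_nhds hx'.1 hx'.2)
  let f : ℝ × ℝ → ℝ := fun p => a p.2 * (u p) ^ 2
  let g : ℝ × ℝ → ℝ := fun p => (a p.2 * u p) ^ 2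
  have hfc : ContinuousOn f D := (hac.comp continuous_snd).continuousOn.mul (huc.pow 2)
  have hgc : ContinuousOn g D := ((hac.comp continuous_snd).continuousOn.mul huc).pow 2
  have ha2 : ∀ p : ℝ × ℝ, DifferentiableAt ℝ (fun p : ℝ × ℝ => a p.2) p := fun p =>
    (had p.2).comp p differentiableAt_snd
  have hfd : ∀ p ∈ O, DifferentiableAt ℝ f p := fun p hp => (ha2 p).mul ((hud p hp).pow 2)
  have hgd : ∀ p ∈ O, DifferentiableAt ℝ g p := fun p hp => ((ha2 p).mul (hud p hp)).pow 2
  have slice1 : ∀ (F : ℝ × ℝ → ℝ) (p : ℝ × ℝ), DifferentiableAt ℝ F p →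
      HasDerivAt (fun s => F (s, p.2)) (fderiv ℝ F p (1, 0)) p.1 := by
    intro F p h
    have h1 : HasDerivAt (fun s : ℝ => (s, p.2)) ((1 : ℝ), (0 : ℝ)) p.1 :=
      (hasDerivAt_id p.1).prodMk (hasDerivAt_const p.1 p.2)
    exact HasFDerivAt.comp_hasDerivAt p.1 (f := fun s : ℝ => (s, p.2)) h.hasFDerivAt h1
  have slice2 : ∀ (F : ℝ × ℝ → ℝ) (p : ℝ × ℝ), DifferentiableAt ℝ F p →
      HasDerivAt (fun y => F (p.1, y)) (fderiv ℝ F p (0, 1)) p.2 := by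
    intro F p h
    have h1 : HasDerivAt (fun y : ℝ => (p.1, y)) ((0 : ℝ), (1 : ℝ)) p.2 :=
      (hasDerivAt_const p.2 p.1).prodMk (hasDerivAt_id p.2)
    exact HasFDerivAt.comp_hasDerivAt p.2 (f := fun y : ℝ => (p.1, y)) h.hasFDerivAt h1
  have hdiv : ∀ p ∈ O, fderiv ℝ f p (1, 0) + fderiv ℝ g p (0, 1) = 0 := by
    intro p hp
    have e1 := slice1 u p (hud p hp)
    have e2 := slice2 (fun p => a p.2 * u p) p ((ha2 p).mul (hud p hp))
    have hP := hpde p.1 hp.1.1.le p.2 ⟨hp.2.1.le, hp.2.2.le⟩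
    have e2' := e2.deriv
    simp only at e2'
    rw [e1.deriv, e2'] at hP
    have k1 := (slice1 f p (hfd p hp)).unique ((e1.pow 2).const_mul (a p.2))
    have k2 := (slice2 g p (hgd p hp)).unique (e2.pow 2)
    rw [k1, k2]
    simp only [Nat.cast_ofNat, Nat.add_one_sub_one, pow_one, Prod.mk.eta]
    linear_combination 2 * a p.2 * u p * hP
  have key := MeasureTheory.integral2_divergence_prod_of_hasFDerivAt_off_countable f g
    (O.indicator (fderiv ℝ f)) (O.indicator (fderiv ℝ g)) 0 xL t xR ∅ Set.countable_empty
  have hz : ∀ p : ℝ × ℝ, O.indicator (fderiv ℝ f) p (1, 0) + O.indicator (fderiv ℝ g) p (0, 1) = 0 := by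
    intro p
    by_cases hp : p ∈ O
    · simpa [hp] using hdiv p hp
    · simp [hp]
  simp only [hz, Set.uIcc_of_le ht, Set.uIcc_of_le hx.le, min_eq_left ht, max_eq_right ht,
    min_eq_left hx.le, max_eq_right hx.le, Set.sdiff_empty] at key
  have key := key hfc hgc
    (fun p hp => by
      rw [Set.indicator_of_mem (show p ∈ O from hp)]; exact (hfd p hp).hasFDerivAt)
    (fun p hp => by
      rw [Set.indicator_of_mem (show p ∈ O from hp)]; exact (hgd p hp).hasFDerivAt)
    (MeasureTheory.integrableOn_zero)
  simp only [intervalIntegral.integral_zero, f, g] at key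
  have hpos : 0 ≤ ∫ τ in (0 : ℝ)..t, (a xR * u (τ, xR)) ^ 2 :=
    intervalIntegral.integral_nonneg ht (fun τ _ => sq_nonneg _)
  simp only [← mul_pow]
  linarith
end

section
/- Let (D, M, R) be an SBP discretisation on n nodes with M diagonal and with boundary nodes included, i.e. (Rv)₀ = v₀ and (Rv)₁ = v_{n−1} for all v ∈ ℝⁿ, and assume D𝟙 = 0. For any a, u ∈ ℝⁿ and any numerical-flux vector f ∈ ℝ², define the split-form semidiscrete right-hand side rhs := −(1/2) D (a∘u) − (1/2) a∘(D u) − (1/2) u∘(D a) − M⁻¹ Rᵀ B ( f − R(a∘u) ). Then the discrete mass rate satisfies 𝟙ᵀ M · rhs = −𝟙ᵀ Rᵀ B f = f₀ − f₁. -/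
open Matrix

/-- for a diagonal-norm SBP discretisation including the boundary
nodes with `D 𝟙 = 0`, the split-form semidiscretisation is conservative:
`𝟙ᵀ M rhs = −𝟙ᵀ Rᵀ B f = f₀ − f₁`. -/
theorem split_form_conservation_boundary_nodes
    (n : ℕ) (D M : Matrix (Fin (n + 1)) (Fin (n + 1)) ℝ)
    (R : Matrix (Fin 2) (Fin (n + 1)) ℝ)
    (B : Matrix (Fin 2) (Fin 2) ℝ) (hB : B = !![(-1 : ℝ), 0; 0, 1])
    (hMpd : M.PosDef) (hMsymm : M.IsSymm)
    (hMdiag : ∀ i j, i ≠ j → M i j = 0)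
    (hSBP : M * D + Dᵀ * M = Rᵀ * B * R)
    (hbound : ∀ v : Fin (n + 1) → ℝ,
      R.mulVec v 0 = v 0 ∧ R.mulVec v 1 = v (Fin.last n))
    (hD1 : D.mulVec (fun _ => (1 : ℝ)) = 0)
    (a u : Fin (n + 1) → ℝ) (f : Fin 2 → ℝ)
    (rhs : Fin (n + 1) → ℝ)
    (hrhs : rhs = -((1 / 2 : ℝ) • D.mulVec (a * u))
      - (1 / 2 : ℝ) • (a * D.mulVec u)
      - (1 / 2 : ℝ) • (u * D.mulVec a)
      - M⁻¹.mulVec (Rᵀ.mulVec (B.mulVec (f - R.mulVec (a * u))))) :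
    (fun _ => (1 : ℝ)) ⬝ᵥ M.mulVec rhs
        = -((fun _ => (1 : ℝ)) ⬝ᵥ Rᵀ.mulVec (B.mulVec f))
      ∧ (fun _ => (1 : ℝ)) ⬝ᵥ M.mulVec rhs = f 0 - f 1 := by
  have hT : ∀ (v : Fin (n + 1) → ℝ) (g : Fin 2 → ℝ),
      v ⬝ᵥ Rᵀ.mulVec (B.mulVec g) = v (Fin.last n) * g 1 - v 0 * g 0 := by
    intro v g
    rw [Matrix.dotProduct_mulVec, Matrix.vecMul_transpose, hB]
    simp only [dotProduct, Matrix.mulVec, Fin.sum_univ_two]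
    have h := hbound v
    simp only [dotProduct, Matrix.mulVec] at h
    rw [h.1, h.2]
    simp
    ring
  have hE : ∀ v w : Fin (n + 1) → ℝ,
      v ⬝ᵥ M.mulVec (D.mulVec w) + D.mulVec v ⬝ᵥ M.mulVec w
        = v (Fin.last n) * w (Fin.last n) - v 0 * w 0 := by
    intro v w
    have h := congrArg (fun A => v ⬝ᵥ A.mulVec w) hSBP
    simp only [Matrix.add_mulVec, dotProduct_add, ← Matrix.mulVec_mulVec] at h
    rw [hT, (hbound w).1, (hbound w).2, Matrix.dotProduct_mulVec v Dᵀ,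
      Matrix.vecMul_transpose] at h
    exact h
  have hM : ∀ (w : Fin (n + 1) → ℝ) i, M.mulVec w i = M i i * w i := by
    intro w i
    simp only [Matrix.mulVec, dotProduct]
    rw [Finset.sum_eq_single i]
    · intro j _ hj
      rw [hMdiag i j hj.symm, zero_mul]
    · simp
  have hP : ∀ v w : Fin (n + 1) → ℝ,
      (fun _ => (1 : ℝ)) ⬝ᵥ M.mulVec (v * w) = v ⬝ᵥ M.mulVec w := by
    intro v w
    simp only [dotProduct, hM, Pi.mul_apply]
    exact Finset.sum_congr rfl fun i _ => by ring
  have h1 := hE (fun _ => 1) (a * u)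
  rw [hD1, zero_dotProduct] at h1
  have h2 := hE a u
  have h3 : D.mulVec a ⬝ᵥ M.mulVec u = (fun _ => (1 : ℝ)) ⬝ᵥ M.mulVec (u * D.mulVec a) := by
    rw [mul_comm, hP]
  have hu : IsUnit M.det := (Matrix.isUnit_iff_isUnit_det M).1 hMpd.isUnit
  have key : (fun _ => (1 : ℝ)) ⬝ᵥ M.mulVec rhs = f 0 - f 1 := by
    rw [hrhs]
    simp only [Matrix.mulVec_sub M, Matrix.mulVec_neg, Matrix.mulVec_smul M, dotProduct_sub,
      dotProduct_neg, dotProduct_smul, smul_eq_mul]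
    rw [Matrix.mulVec_mulVec _ M M⁻¹, Matrix.mul_nonsing_inv _ hu, Matrix.one_mulVec, hT,
      ← h3, hP a]
    simp only [Pi.sub_apply, (hbound _).1, (hbound _).2, Pi.mul_apply] at h1 ⊢
    linarith
  refine ⟨?_, key⟩
  rw [key, hT]
  ring
end

section
/- Let (D, M, R) be an SBP discretisation on n nodes with M diagonal and with boundary nodes included, i.e. (Rv)₀ = v₀ and (Rv)₁ = v_{n−1} for all v ∈ ℝⁿ. For a, u ∈ ℝⁿ and a boundary datum g ∈ ℝ, take the upwind numerical flux f ∈ ℝ² with f₀ = a₀ g and f₁ = a_{n−1} u_{n−1}, and define rhs := −(1/2) D (a∘u) − (1/2) a∘(D u) − (1/2) u∘(D a) − M⁻¹ Rᵀ B ( f − R(a∘u) ). Then the discrete energy rate satisfies 2 uᵀ M · rhs = a₀ g² − a_{n−1} u_{n−1}² − (u∘u)ᵀ M (D a) − a₀ (u₀ − g)². -/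
open Matrix

/-- for a diagonal-norm SBP discretisation including the boundary
nodes, the split form with the upwind flux `f = (a₀ g, a_{n-1} u_{n-1})`
satisfies the discrete energy rate
`2 uᵀ M rhs = a₀ g² − a_N u_N² − (u∘u)ᵀ M (D a) − a₀ (u₀ − g)²`. -/
theorem split_form_energy_rate_boundary_nodes
    (n : ℕ) (D M : Matrix (Fin (n + 1)) (Fin (n + 1)) ℝ)
    (R : Matrix (Fin 2) (Fin (n + 1)) ℝ)
    (B : Matrix (Fin 2) (Fin 2) ℝ) (hB : B = !![(-1 : ℝ), 0; 0, 1])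
    (hMpd : M.PosDef) (hMsymm : M.IsSymm)
    (hMdiag : ∀ i j, i ≠ j → M i j = 0)
    (hSBP : M * D + Dᵀ * M = Rᵀ * B * R)
    (hbound : ∀ v : Fin (n + 1) → ℝ,
      R.mulVec v 0 = v 0 ∧ R.mulVec v 1 = v (Fin.last n))
    (a u : Fin (n + 1) → ℝ) (g : ℝ) (f : Fin 2 → ℝ)
    (hf0 : f 0 = a 0 * g) (hf1 : f 1 = a (Fin.last n) * u (Fin.last n))
    (rhs : Fin (n + 1) → ℝ)
    (hrhs : rhs = -((1 / 2 : ℝ) • D.mulVec (a * u))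
      - (1 / 2 : ℝ) • (a * D.mulVec u)
      - (1 / 2 : ℝ) • (u * D.mulVec a)
      - M⁻¹.mulVec (Rᵀ.mulVec (B.mulVec (f - R.mulVec (a * u))))) :
    2 * (u ⬝ᵥ M.mulVec rhs)
      = a 0 * g ^ 2 - a (Fin.last n) * (u (Fin.last n)) ^ 2
        - (u * u) ⬝ᵥ M.mulVec (D.mulVec a)
        - a 0 * (u 0 - g) ^ 2 := by
  have hunit : IsUnit M.det := hMpd.isUnit.map Matrix.detMonoidHom
  have hMM : ∀ v : Fin (n + 1) → ℝ, M *ᵥ (M⁻¹ *ᵥ v) = v := by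
    intro v
    rw [Matrix.mulVec_mulVec, Matrix.mul_nonsing_inv _ hunit, Matrix.one_mulVec]
  have hMv : ∀ (v : Fin (n + 1) → ℝ) i, (M *ᵥ v) i = M i i * v i := by
    intro v i
    simp only [Matrix.mulVec, dotProduct]
    refine Finset.sum_eq_single i ?_ ?_
    · intro j _ hj
      rw [hMdiag i j (Ne.symm hj), zero_mul]
    · simp
  have hmove : ∀ x y z : Fin (n + 1) → ℝ, x ⬝ᵥ M *ᵥ (y * z) = (y * x) ⬝ᵥ M *ᵥ z := by
    intro x y z
    simp only [dotProduct, hMv, Pi.mul_apply]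
    refine Finset.sum_congr rfl fun i _ => ?_
    ring
  have hR : ∀ (x : Fin (n + 1) → ℝ) (y : Fin 2 → ℝ),
      x ⬝ᵥ Rᵀ *ᵥ (B *ᵥ y) = - (x 0 * y 0) + x (Fin.last n) * y 1 := by
    intro x y
    rw [Matrix.dotProduct_mulVec, Matrix.vecMul_transpose, hB]
    simp [dotProduct, Matrix.mulVec, Fin.sum_univ_two]
    have h0 := (hbound x).1
    have h1 := (hbound x).2
    simp only [Matrix.mulVec, dotProduct] at h0 h1
    rw [h0, h1]
  have hS : ∀ x y : Fin (n + 1) → ℝ, x ⬝ᵥ M *ᵥ (D *ᵥ y) + y ⬝ᵥ M *ᵥ (D *ᵥ x)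
      = - (x 0 * y 0) + x (Fin.last n) * y (Fin.last n) := by
    intro x y
    have h1 : y ⬝ᵥ M *ᵥ (D *ᵥ x) = x ⬝ᵥ (Dᵀ * M) *ᵥ y := by
      rw [← Matrix.mulVec_mulVec, Matrix.dotProduct_mulVec x, Matrix.vecMul_transpose,
        Matrix.dotProduct_mulVec, ← Matrix.mulVec_transpose, hMsymm.eq, dotProduct_comm]
    rw [h1, Matrix.mulVec_mulVec, ← dotProduct_add, ← Matrix.add_mulVec, hSBP,
      ← Matrix.mulVec_mulVec, ← Matrix.mulVec_mulVec, hR, (hbound y).1, (hbound y).2]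
  have e := hS u (a * u)
  have hb := hR u (f - R *ᵥ (a * u))
  simp only [Pi.sub_apply, (hbound (a * u)).1, (hbound (a * u)).2, hf0, hf1,
    Pi.mul_apply] at hb e
  rw [hrhs]
  simp only [Matrix.mulVec_sub, Matrix.mulVec_neg, Matrix.mulVec_smul, dotProduct_sub,
    dotProduct_neg, dotProduct_smul, smul_eq_mul, hMM, hmove]
  rw [Matrix.mulVec_sub, Matrix.mulVec_sub, dotProduct_sub] at hb
  linear_combination (-1) * e - 2 * hb
end

section
/- Let (D, M, R) be an SBP discretisation on n nodes with D𝟙 = 0 and R𝟙 = (1,1)ᵀ. For a, u ∈ ℝⁿ let A = diag(a), U = diag(u), and define the M-adjoint multiplication operators A* = M⁻¹ Aᵀ M and U* = M⁻¹ Uᵀ M. For any numerical-flux vector f ∈ ℝ², define the corrected general-SBP right-hand side rhs := −(1/2) D (a∘u) − (1/2) A* D u − (1/2) U* D a − M⁻¹ Rᵀ B ( f − (1/2) R(a∘u) − (1/2) (R a)∘(R u) ). Then the discrete mass rate satisfies 𝟙ᵀ M · rhs = −(R𝟙)ᵀ B f = f₀ − f₁. -/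
open Matrix

/-- for a general SBP discretisation with `D 𝟙 = 0` and
`R 𝟙 = (1,1)ᵀ`, the corrected split-form semidiscretisation is conservative:
`𝟙ᵀ M rhs = −(R𝟙)ᵀ B f = f₀ − f₁`. -/
theorem corrected_split_form_conservation_general_SBP
    (n : ℕ) (D M : Matrix (Fin n) (Fin n) ℝ)
    (R : Matrix (Fin 2) (Fin n) ℝ)
    (B : Matrix (Fin 2) (Fin 2) ℝ) (hB : B = !![(-1 : ℝ), 0; 0, 1])
    (hMpd : M.PosDef) (hMsymm : M.IsSymm)
    (hSBP : M * D + Dᵀ * M = Rᵀ * B * R)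
    (hD1 : D.mulVec (fun _ => (1 : ℝ)) = 0)
    (hR1 : R.mulVec (fun _ => (1 : ℝ)) = ![1, 1])
    (a u : Fin n → ℝ) (f : Fin 2 → ℝ)
    (A U Astar Ustar : Matrix (Fin n) (Fin n) ℝ)
    (hA : A = Matrix.diagonal a) (hU : U = Matrix.diagonal u)
    (hAstar : Astar = M⁻¹ * Aᵀ * M) (hUstar : Ustar = M⁻¹ * Uᵀ * M)
    (rhs : Fin n → ℝ)
    (hrhs : rhs = -((1 / 2 : ℝ) • D.mulVec (a * u))
      - (1 / 2 : ℝ) • Astar.mulVec (D.mulVec u)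
      - (1 / 2 : ℝ) • Ustar.mulVec (D.mulVec a)
      - M⁻¹.mulVec (Rᵀ.mulVec (B.mulVec
          (f - (1 / 2 : ℝ) • R.mulVec (a * u)
             - (1 / 2 : ℝ) • (R.mulVec a * R.mulVec u))))) :
    (fun _ => (1 : ℝ)) ⬝ᵥ M.mulVec rhs
        = -(R.mulVec (fun _ => (1 : ℝ)) ⬝ᵥ B.mulVec f)
      ∧ (fun _ => (1 : ℝ)) ⬝ᵥ M.mulVec rhs = f 0 - f 1 := by
  have hdet : IsUnit M.det := hMpd.det_pos.ne'.isUnit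
  have key : ∀ x y : Fin n → ℝ, x ⬝ᵥ M *ᵥ (D *ᵥ y) + (D *ᵥ x) ⬝ᵥ M *ᵥ y
      = (R *ᵥ x) ⬝ᵥ B *ᵥ (R *ᵥ y) := by
    intro x y
    have h := congrArg (fun X : Matrix (Fin n) (Fin n) ℝ => x ⬝ᵥ X *ᵥ y) hSBP
    simp only [Matrix.add_mulVec, dotProduct_add, ← Matrix.mulVec_mulVec] at h
    rw [Matrix.dotProduct_mulVec x Dᵀ, Matrix.dotProduct_mulVec x Rᵀ,
      Matrix.vecMul_transpose, Matrix.vecMul_transpose] at h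
    exact h
  have hsym : ∀ x y : Fin n → ℝ, x ⬝ᵥ M *ᵥ y = y ⬝ᵥ M *ᵥ x := by
    intro x y
    rw [Matrix.dotProduct_mulVec, ← Matrix.mulVec_transpose, hMsymm.eq, dotProduct_comm]
  have hMM : ∀ x : Fin n → ℝ, M *ᵥ (M⁻¹ *ᵥ x) = x := by
    intro x
    rw [Matrix.mulVec_mulVec, Matrix.mul_nonsing_inv _ hdet, Matrix.one_mulVec]
  have hdiag : ∀ v x : Fin n → ℝ, (fun _ => (1 : ℝ)) ⬝ᵥ (Matrix.diagonal v) *ᵥ x = v ⬝ᵥ x := by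
    intro v x
    simp [dotProduct, Matrix.mulVec_diagonal]
  have hRt : ∀ x : Fin 2 → ℝ, (fun _ => (1 : ℝ)) ⬝ᵥ Rᵀ *ᵥ x = ![1, 1] ⬝ᵥ x := by
    intro x
    rw [Matrix.dotProduct_mulVec, Matrix.vecMul_transpose, hR1]
  have k1 := key (fun _ => 1) (a * u)
  rw [hD1, hR1, zero_dotProduct, add_zero] at k1
  have k2 := key a u
  rw [hsym (D *ᵥ a) u] at k2
  have main : (fun _ => (1 : ℝ)) ⬝ᵥ M *ᵥ rhs = f 0 - f 1 := by
    rw [hrhs, hAstar, hUstar, hA, hU]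
    simp only [Matrix.diagonal_transpose, ← Matrix.mulVec_mulVec, Matrix.mulVec_sub,
      Matrix.mulVec_neg, Matrix.mulVec_smul, hMM, dotProduct_sub, dotProduct_neg,
      dotProduct_smul, hdiag, hRt, k1, smul_eq_mul]
    have k3 : (R *ᵥ a) ⬝ᵥ B *ᵥ (R *ᵥ u) = ![1, 1] ⬝ᵥ B *ᵥ (R *ᵥ a * R *ᵥ u) := by
      subst hB
      simp [dotProduct, Fin.sum_univ_two, Matrix.mulVec, Matrix.vecHead, Matrix.vecTail]
    have k4 : ![1, 1] ⬝ᵥ B *ᵥ f = f 1 - f 0 := by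
      subst hB
      simp [dotProduct, Fin.sum_univ_two, Matrix.mulVec, Matrix.vecHead, Matrix.vecTail]
      ring
    rw [k3] at k2
    linarith
  refine ⟨?_, main⟩
  rw [main, hR1]
  subst hB
  simp [dotProduct, Fin.sum_univ_two, Matrix.mulVec, Matrix.vecHead, Matrix.vecTail]
  try ring
end

section
/- Let (D, M, R) be an SBP discretisation on n nodes. For a, u ∈ ℝⁿ let A = diag(a), U = diag(u), A* = M⁻¹ Aᵀ M, U* = M⁻¹ Uᵀ M, and for any numerical-flux vector f ∈ ℝ² define rhs := −(1/2) D (a∘u) − (1/2) A* D u − (1/2) U* D a − M⁻¹ Rᵀ B ( f − (1/2) R(a∘u) − (1/2) (R a)∘(R u) ). Then the discrete energy rate satisfies 2 uᵀ M · rhs = −(u∘u)ᵀ M (D a) − 2 (R u)ᵀ B f + (R u)ᵀ B ( (R a)∘(R u) ). -/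
open Matrix

/-- for a general SBP discretisation, the corrected split-form
semidiscretisation satisfies the discrete energy rate
`2 uᵀ M rhs = −(u∘u)ᵀ M (D a) − 2 (Ru)ᵀ B f + (Ru)ᵀ B ((Ra)∘(Ru))`. -/
theorem corrected_split_form_energy_rate_general_SBP
    (n : ℕ) (D M : Matrix (Fin n) (Fin n) ℝ)
    (R : Matrix (Fin 2) (Fin n) ℝ)
    (B : Matrix (Fin 2) (Fin 2) ℝ) (hB : B = !![(-1 : ℝ), 0; 0, 1])
    (hMpd : M.PosDef) (hMsymm : M.IsSymm)
    (hSBP : M * D + Dᵀ * M = Rᵀ * B * R)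
    (a u : Fin n → ℝ) (f : Fin 2 → ℝ)
    (A U Astar Ustar : Matrix (Fin n) (Fin n) ℝ)
    (hA : A = Matrix.diagonal a) (hU : U = Matrix.diagonal u)
    (hAstar : Astar = M⁻¹ * Aᵀ * M) (hUstar : Ustar = M⁻¹ * Uᵀ * M)
    (rhs : Fin n → ℝ)
    (hrhs : rhs = -((1 / 2 : ℝ) • D.mulVec (a * u))
      - (1 / 2 : ℝ) • Astar.mulVec (D.mulVec u)
      - (1 / 2 : ℝ) • Ustar.mulVec (D.mulVec a)
      - M⁻¹.mulVec (Rᵀ.mulVec (B.mulVec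
          (f - (1 / 2 : ℝ) • R.mulVec (a * u)
             - (1 / 2 : ℝ) • (R.mulVec a * R.mulVec u))))) :
    2 * (u ⬝ᵥ M.mulVec rhs)
      = -((u * u) ⬝ᵥ M.mulVec (D.mulVec a))
        - 2 * (R.mulVec u ⬝ᵥ B.mulVec f)
        + R.mulVec u ⬝ᵥ B.mulVec (R.mulVec a * R.mulVec u) := by
  have hdet : IsUnit M.det := hMpd.det_pos.ne'.isUnit
  have hinv : M * M⁻¹ = 1 := Matrix.mul_nonsing_inv M hdet
  have hc : ∀ v, M *ᵥ (M⁻¹ *ᵥ v) = v := by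
    intro v
    rw [Matrix.mulVec_mulVec, hinv, Matrix.one_mulVec]
  have hd : ∀ b v : Fin n → ℝ, u ⬝ᵥ (Matrix.diagonal b *ᵥ v) = (b * u) ⬝ᵥ v := by
    intro b v
    simp only [dotProduct, Matrix.mulVec_diagonal, Pi.mul_apply]
    exact Finset.sum_congr rfl fun i _ => by ring
  have hR : ∀ w : Fin 2 → ℝ, u ⬝ᵥ (Rᵀ *ᵥ w) = R *ᵥ u ⬝ᵥ w := by
    intro w
    rw [Matrix.dotProduct_mulVec, Matrix.vecMul_transpose]
  have hA' : Astar *ᵥ (D *ᵥ u) = M⁻¹ *ᵥ (Matrix.diagonal a *ᵥ (M *ᵥ (D *ᵥ u))) := by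
    rw [hAstar, hA, Matrix.diagonal_transpose, ← Matrix.mulVec_mulVec, ← Matrix.mulVec_mulVec]
  have hU' : Ustar *ᵥ (D *ᵥ a) = M⁻¹ *ᵥ (Matrix.diagonal u *ᵥ (M *ᵥ (D *ᵥ a))) := by
    rw [hUstar, hU, Matrix.diagonal_transpose, ← Matrix.mulVec_mulVec, ← Matrix.mulVec_mulVec]
  have h1 : u ⬝ᵥ (Dᵀ *ᵥ (M *ᵥ (a * u))) = (a * u) ⬝ᵥ (M *ᵥ (D *ᵥ u)) := by
    rw [Matrix.dotProduct_mulVec, Matrix.vecMul_transpose, Matrix.dotProduct_mulVec,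
      ← Matrix.mulVec_transpose, hMsymm.eq, dotProduct_comm]
  have h2 := congrArg (fun X => u ⬝ᵥ (X *ᵥ (a * u))) hSBP
  simp only [Matrix.add_mulVec, dotProduct_add, ← Matrix.mulVec_mulVec, h1, hR] at h2
  rw [hrhs, hA', hU']
  simp only [Matrix.mulVec_sub, Matrix.mulVec_neg, Matrix.mulVec_smul, hc, dotProduct_sub,
    dotProduct_neg, dotProduct_smul, hd, hR, smul_eq_mul]
  linarith
end

section
/- Let (D, M, R) be an SBP discretisation on n nodes, let a, u ∈ ℝⁿ, set A = diag(a), U = diag(u), A* = M⁻¹ Aᵀ M, U* = M⁻¹ Uᵀ M, and write α_L = (R a)₀, α_R = (R a)₁, u_L = (R u)₀, u_R = (R u)₁. For a boundary datum g ∈ ℝ choose the split upwind numerical flux f ∈ ℝ² with f₀ = α_L g and f₁ = α_R u_R, and define rhs := −(1/2) D (a∘u) − (1/2) A* D u − (1/2) U* D a − M⁻¹ Rᵀ B ( f − (1/2) R(a∘u) − (1/2) (R a)∘(R u) ). Then 2 uᵀ M · rhs = α_L g² − α_R u_R² − (u∘u)ᵀ M (D a) − α_L (u_L − g)². In particular,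 if the interpolated speeds are exact, α_L = a(x_L) and α_R = a(x_R), this mimics the continuous weighted-free energy rate d/dt ∫ u² = a(x_L) g² − a(x_R) u(x_R)² − ∫ u² ∂_x a with the additional dissipative term −a(x_L)(u_L − g)². -/
open Matrix

/-- for a general SBP discretisation, the corrected split-form
semidiscretisation with the split upwind flux `f = (αL g, αR uR)`, where
`αL = (Ra)₀`, `αR = (Ra)₁`, `uL = (Ru)₀`, `uR = (Ru)₁`, satisfies
`2 uᵀ M rhs = αL g² − αR uR² − (u∘u)ᵀ M (D a) − αL (uL − g)²`. -/
theorem corrected_split_form_upwind_energy_rate_general_SBP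
    (n : ℕ) (D M : Matrix (Fin n) (Fin n) ℝ)
    (R : Matrix (Fin 2) (Fin n) ℝ)
    (B : Matrix (Fin 2) (Fin 2) ℝ) (hB : B = !![(-1 : ℝ), 0; 0, 1])
    (hMpd : M.PosDef) (hMsymm : M.IsSymm)
    (hSBP : M * D + Dᵀ * M = Rᵀ * B * R)
    (a u : Fin n → ℝ) (g : ℝ)
    (A U Astar Ustar : Matrix (Fin n) (Fin n) ℝ)
    (hA : A = Matrix.diagonal a) (hU : U = Matrix.diagonal u)
    (hAstar : Astar = M⁻¹ * Aᵀ * M) (hUstar : Ustar = M⁻¹ * Uᵀ * M)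
    (f : Fin 2 → ℝ)
    (hf0 : f 0 = R.mulVec a 0 * g)
    (hf1 : f 1 = R.mulVec a 1 * R.mulVec u 1)
    (rhs : Fin n → ℝ)
    (hrhs : rhs = -((1 / 2 : ℝ) • D.mulVec (a * u))
      - (1 / 2 : ℝ) • Astar.mulVec (D.mulVec u)
      - (1 / 2 : ℝ) • Ustar.mulVec (D.mulVec a)
      - M⁻¹.mulVec (Rᵀ.mulVec (B.mulVec
          (f - (1 / 2 : ℝ) • R.mulVec (a * u)
             - (1 / 2 : ℝ) • (R.mulVec a * R.mulVec u))))) :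
    2 * (u ⬝ᵥ M.mulVec rhs)
      = R.mulVec a 0 * g ^ 2
        - R.mulVec a 1 * (R.mulVec u 1) ^ 2
        - (u * u) ⬝ᵥ M.mulVec (D.mulVec a)
        - R.mulVec a 0 * (R.mulVec u 0 - g) ^ 2 := by
  have hdet : IsUnit M.det := (Matrix.isUnit_iff_isUnit_det M).mp hMpd.isUnit
  have hMM : M * M⁻¹ = 1 := Matrix.mul_nonsing_inv M hdet
  have hdiag : ∀ b v : Fin n → ℝ, u ⬝ᵥ (Matrix.diagonal b).mulVec v = (b * u) ⬝ᵥ v := by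
    intro b v
    simp only [dotProduct, Matrix.mulVec_diagonal, Pi.mul_apply]
    exact Finset.sum_congr rfl fun i _ => by ring
  have hAs : M * Astar = Matrix.diagonal a * M := by
    rw [hAstar, hA, Matrix.diagonal_transpose, ← Matrix.mul_assoc, ← Matrix.mul_assoc, hMM,
      Matrix.one_mul]
  have hUs : M * Ustar = Matrix.diagonal u * M := by
    rw [hUstar, hU, Matrix.diagonal_transpose, ← Matrix.mul_assoc, ← Matrix.mul_assoc, hMM,
      Matrix.one_mul]
  have h2 : u ⬝ᵥ M.mulVec (Astar.mulVec (D.mulVec u)) = (a * u) ⬝ᵥ M.mulVec (D.mulVec u) := by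
    rw [Matrix.mulVec_mulVec, hAs, ← Matrix.mulVec_mulVec, hdiag]
  have h3 : u ⬝ᵥ M.mulVec (Ustar.mulVec (D.mulVec a)) = (u * u) ⬝ᵥ M.mulVec (D.mulVec a) := by
    rw [Matrix.mulVec_mulVec, hUs, ← Matrix.mulVec_mulVec, hdiag]
  have hR : ∀ w : Fin 2 → ℝ, u ⬝ᵥ Rᵀ.mulVec (B.mulVec w)
      = -(R.mulVec u 0 * w 0) + R.mulVec u 1 * w 1 := by
    intro w
    rw [Matrix.dotProduct_mulVec, Matrix.vecMul_transpose, hB]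
    simp [dotProduct, Matrix.mulVec, Fin.sum_univ_two]
  have h4 : ∀ w : Fin n → ℝ, u ⬝ᵥ M.mulVec (M⁻¹.mulVec w) = u ⬝ᵥ w := by
    intro w
    rw [Matrix.mulVec_mulVec, hMM, Matrix.one_mulVec]
  have h5 : (a * u) ⬝ᵥ M.mulVec (D.mulVec u) = u ⬝ᵥ (Dᵀ * M).mulVec (a * u) := by
    rw [Matrix.mulVec_mulVec, Matrix.dotProduct_mulVec, ← Matrix.mulVec_transpose,
      Matrix.transpose_mul, hMsymm.eq, dotProduct_comm]
  have h6 : u ⬝ᵥ M.mulVec (D.mulVec (a * u)) + (a * u) ⬝ᵥ M.mulVec (D.mulVec u)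
      = -(R.mulVec u 0 * R.mulVec (a * u) 0) + R.mulVec u 1 * R.mulVec (a * u) 1 := by
    rw [h5, Matrix.mulVec_mulVec, ← dotProduct_add, ← Matrix.add_mulVec, hSBP,
      ← Matrix.mulVec_mulVec, ← Matrix.mulVec_mulVec, hR]
  rw [hrhs]
  simp only [Matrix.mulVec_sub, Matrix.mulVec_neg, Matrix.mulVec_smul, dotProduct_sub,
    dotProduct_neg, dotProduct_smul, smul_eq_mul, h2, h3, h4, hR, Pi.sub_apply, Pi.smul_apply,
    Pi.mul_apply, hf0, hf1]
  linear_combination (-1 : ℝ) * h6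
end

section
/- Let (D, M, R) be an SBP discretisation on n nodes. For a, u ∈ ℝⁿ let A = diag(a), and for any numerical-flux vector f ∈ ℝ² define rhs := −D (a∘u) − M⁻¹ Rᵀ B ( f − R(a∘u) ). Then the weighted discrete energy rate satisfies 2 uᵀ Aᵀ M · rhs = (R(a∘u))ᵀ B (R(a∘u)) − 2 (R(a∘u))ᵀ B f. -/
open Matrix

/-- for a general SBP discretisation, the unsplit-form
semidiscretisation satisfies the weighted discrete energy rate
`2 uᵀ Aᵀ M rhs = (R(a∘u))ᵀ B (R(a∘u)) − 2 (R(a∘u))ᵀ B f`. -/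
theorem unsplit_form_weighted_energy_rate_general_SBP
    (n : ℕ) (D M : Matrix (Fin n) (Fin n) ℝ)
    (R : Matrix (Fin 2) (Fin n) ℝ)
    (B : Matrix (Fin 2) (Fin 2) ℝ) (hB : B = !![(-1 : ℝ), 0; 0, 1])
    (hMpd : M.PosDef) (hMsymm : M.IsSymm)
    (hSBP : M * D + Dᵀ * M = Rᵀ * B * R)
    (a u : Fin n → ℝ) (f : Fin 2 → ℝ)
    (A : Matrix (Fin n) (Fin n) ℝ) (hA : A = Matrix.diagonal a)
    (rhs : Fin n → ℝ)
    (hrhs : rhs = -(D.mulVec (a * u))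
      - M⁻¹.mulVec (Rᵀ.mulVec (B.mulVec (f - R.mulVec (a * u))))) :
    2 * (u ⬝ᵥ (Aᵀ * M).mulVec rhs)
      = R.mulVec (a * u) ⬝ᵥ B.mulVec (R.mulVec (a * u))
        - 2 * (R.mulVec (a * u) ⬝ᵥ B.mulVec f) := by
  have hu : IsUnit M.det := hMpd.det_pos.ne'.isUnit
  have h1 : ∀ v : Fin n → ℝ, u ⬝ᵥ (Aᵀ * M).mulVec v = (a * u) ⬝ᵥ M.mulVec v := by
    intro v
    rw [← Matrix.mulVec_mulVec, hA, Matrix.diagonal_transpose]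
    simp only [dotProduct, Matrix.mulVec_diagonal, Pi.mul_apply]
    exact Finset.sum_congr rfl fun i _ => by ring
  rw [h1]
  generalize a * u = w at *
  have hR : ∀ v : Fin 2 → ℝ, w ⬝ᵥ Rᵀ.mulVec v = R.mulVec w ⬝ᵥ v := by
    intro v
    rw [Matrix.dotProduct_mulVec, Matrix.vecMul_transpose]
  have h2 : M.mulVec rhs = -(M.mulVec (D.mulVec w))
      - Rᵀ.mulVec (B.mulVec (f - R.mulVec w)) := by
    rw [hrhs, Matrix.mulVec_sub, Matrix.mulVec_neg, Matrix.mulVec_mulVec _ M M⁻¹,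
      Matrix.mul_nonsing_inv _ hu, Matrix.one_mulVec]
  have h3 : w ⬝ᵥ Dᵀ.mulVec (M.mulVec w) = w ⬝ᵥ M.mulVec (D.mulVec w) := by
    rw [Matrix.dotProduct_mulVec, Matrix.vecMul_transpose, Matrix.dotProduct_mulVec w M,
      ← Matrix.mulVec_transpose M w, hMsymm.eq, dotProduct_comm]
  have h4 := congrArg (fun X : Matrix (Fin n) (Fin n) ℝ => w ⬝ᵥ X.mulVec w) hSBP
  simp only [Matrix.add_mulVec, dotProduct_add, ← Matrix.mulVec_mulVec, hR, h3] at h4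
  rw [h2, dotProduct_sub, dotProduct_neg, hR, Matrix.mulVec_sub, dotProduct_sub]
  linarith
end

section
/- Let (D, M, R) be an SBP discretisation on n nodes, let a, u ∈ ℝⁿ, A = diag(a), and write (au)_L = (R(a∘u))₀ and (au)_R = (R(a∘u))₁. For a boundary datum h ∈ ℝ (representing the value a(x_L) g_L at the left boundary), take the unsplit upwind numerical flux f ∈ ℝ² with f₀ = h and f₁ = (au)_R, and define rhs := −D (a∘u) − M⁻¹ Rᵀ B ( f − R(a∘u) ). Then 2 uᵀ Aᵀ M · rhs = h² − (au)_R² − ( h − (au)_L )², and in particular 2 uᵀ Aᵀ M · rhs ≤ h² − (au)_R² ≤ h². Hence, whenever Aᵀ M is symmetric and positive definite, the semidiscretisation is stable in the discrete weighted norm ‖·‖_{AᵀM}, mimicking the continuous estimate d/dt ‖u‖²_{L²_a} = a(x_L)² g_L² − a(x_R)² u(x_R)² with an additional dissipative term. -/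
open Matrix

/-- for a general SBP discretisation, the unsplit-form
semidiscretisation with the unsplit upwind flux `f = (h, (au)_R)` (with
`(au)_L = (R(a∘u))₀`, `(au)_R = (R(a∘u))₁` and boundary datum `h`) satisfies
`2 uᵀ Aᵀ M rhs = h² − (au)_R² − (h − (au)_L)²`, and in particular
`2 uᵀ Aᵀ M rhs ≤ h² − (au)_R² ≤ h²`. -/
theorem unsplit_form_upwind_weighted_energy_estimate_general_SBP
    (n : ℕ) (D M : Matrix (Fin n) (Fin n) ℝ)
    (R : Matrix (Fin 2) (Fin n) ℝ)
    (B : Matrix (Fin 2) (Fin 2) ℝ) (hB : B = !![(-1 : ℝ), 0; 0, 1])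
    (hMpd : M.PosDef) (hMsymm : M.IsSymm)
    (hSBP : M * D + Dᵀ * M = Rᵀ * B * R)
    (a u : Fin n → ℝ) (h : ℝ)
    (A : Matrix (Fin n) (Fin n) ℝ) (hA : A = Matrix.diagonal a)
    (f : Fin 2 → ℝ)
    (hf0 : f 0 = h) (hf1 : f 1 = R.mulVec (a * u) 1)
    (rhs : Fin n → ℝ)
    (hrhs : rhs = -(D.mulVec (a * u))
      - M⁻¹.mulVec (Rᵀ.mulVec (B.mulVec (f - R.mulVec (a * u))))) :
    2 * (u ⬝ᵥ (Aᵀ * M).mulVec rhs)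
        = h ^ 2 - (R.mulVec (a * u) 1) ^ 2 - (h - R.mulVec (a * u) 0) ^ 2
      ∧ 2 * (u ⬝ᵥ (Aᵀ * M).mulVec rhs) ≤ h ^ 2 - (R.mulVec (a * u) 1) ^ 2
      ∧ 2 * (u ⬝ᵥ (Aᵀ * M).mulVec rhs) ≤ h ^ 2 := by
  have hdet : IsUnit M.det := hMpd.det_pos.ne'.isUnit
  have hw : ∀ v, u ⬝ᵥ (Aᵀ * M).mulVec v = (a * u) ⬝ᵥ M.mulVec v := by
    intro v
    rw [← Matrix.mulVec_mulVec, hA, Matrix.diagonal_transpose]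
    simp only [dotProduct, Matrix.mulVec_diagonal, Pi.mul_apply]
    exact Finset.sum_congr rfl fun i _ => by ring
  rw [hw]
  generalize a * u = w at *
  have hE : 2 * (w ⬝ᵥ M.mulVec (D.mulVec w)) = (R.mulVec w 1) ^ 2 - (R.mulVec w 0) ^ 2 := by
    have h1 : w ⬝ᵥ (Dᵀ * M).mulVec w = w ⬝ᵥ (M * D).mulVec w := by
      have ht : Dᵀ * M = (M * D)ᵀ := by rw [Matrix.transpose_mul, hMsymm.eq]
      rw [ht, Matrix.mulVec_transpose, dotProduct_comm, ← Matrix.dotProduct_mulVec]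
    have h2 : w ⬝ᵥ (M * D + Dᵀ * M).mulVec w = w ⬝ᵥ (Rᵀ * B * R).mulVec w := by rw [hSBP]
    rw [Matrix.add_mulVec, dotProduct_add, h1, Matrix.mul_assoc, ← Matrix.mulVec_mulVec,
      ← Matrix.mulVec_mulVec, ← Matrix.mulVec_mulVec, Matrix.dotProduct_mulVec w Rᵀ,
      Matrix.vecMul_transpose, hB] at h2
    generalize R.mulVec w = r at *
    simp [dotProduct, Matrix.mulVec, Fin.sum_univ_two] at h2 ⊢
    linarith
  have key : 2 * (w ⬝ᵥ M.mulVec rhs)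
      = h ^ 2 - (R.mulVec w 1) ^ 2 - (h - R.mulVec w 0) ^ 2 := by
    rw [hrhs, Matrix.mulVec_sub, Matrix.mulVec_neg, Matrix.mulVec_mulVec _ M M⁻¹,
      Matrix.mul_nonsing_inv M hdet, Matrix.one_mulVec, dotProduct_sub, dotProduct_neg,
      Matrix.dotProduct_mulVec w Rᵀ, Matrix.vecMul_transpose]
    have h3 : R.mulVec w ⬝ᵥ B.mulVec (f - R.mulVec w)
        = - (R.mulVec w 0 * (h - R.mulVec w 0)) := by
      rw [hB]
      generalize R.mulVec w = r at *
      simp only [dotProduct, Matrix.mulVec, Fin.sum_univ_two, Pi.sub_apply, hf0, hf1]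
      simp
      ring
    rw [h3]
    linarith
  refine ⟨key, ?_, ?_⟩
  · nlinarith [sq_nonneg (h - R.mulVec w 0)]
  · nlinarith [sq_nonneg (h - R.mulVec w 0), sq_nonneg (R.mulVec w 1)]
end

section
/- Let (D, M, R) be an SBP discretisation on n nodes and let a, u ∈ ℝⁿ with all entries of a nonzero, A = diag(a), A* = M⁻¹ Aᵀ M. For any modified numerical-flux vector f̃ ∈ ℝ², define the nonconservative right-hand side rhs := −A* D u − A* M⁻¹ Rᵀ B f̃ + A* M⁻¹ Rᵀ B R u. Then the 1/a-weighted discrete energy rate satisfies 2 uᵀ (Aᵀ)⁻¹ M · rhs = (R u)ᵀ B (R u) − 2 (R u)ᵀ B f̃. Moreover, for a boundary datum g ∈ ℝ and the modified upwind flux f̃₀ = g, f̃₁ = (R u)₁, this equals g² − (R u)₁² − ((R u)₀ − g)² ≤ g², mimicking the continuous estimate d/dt ‖u‖²_{L²_{1/a}} = g_L² − u(x_R)² with an additional dissipative term. -/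
open Matrix

/-- for a general SBP discretisation of the nonconservative
equation, with `A = diag(a)` (all entries of `a` nonzero) and
`A* = M⁻¹ Aᵀ M`, the semidiscretisation
`rhs = −A* D u − A* M⁻¹ Rᵀ B f̃ + A* M⁻¹ Rᵀ B R u` satisfies the
`1/a`-weighted discrete energy rate
`2 uᵀ (Aᵀ)⁻¹ M rhs = (Ru)ᵀ B (Ru) − 2 (Ru)ᵀ B f̃`; for the modified upwind
flux `f̃ = (g, (Ru)₁)` this equals `g² − (Ru)₁² − ((Ru)₀ − g)² ≤ g²`. -/
theorem nonconservative_weighted_energy_rate_general_SBP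
    (n : ℕ) (D M : Matrix (Fin n) (Fin n) ℝ)
    (R : Matrix (Fin 2) (Fin n) ℝ)
    (B : Matrix (Fin 2) (Fin 2) ℝ) (hB : B = !![(-1 : ℝ), 0; 0, 1])
    (hMpd : M.PosDef) (hMsymm : M.IsSymm)
    (hSBP : M * D + Dᵀ * M = Rᵀ * B * R)
    (a u : Fin n → ℝ) (ha : ∀ i, a i ≠ 0)
    (A Astar : Matrix (Fin n) (Fin n) ℝ)
    (hA : A = Matrix.diagonal a) (hAstar : Astar = M⁻¹ * Aᵀ * M)
    (ftil : Fin 2 → ℝ)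
    (rhs : Fin n → ℝ)
    (hrhs : rhs = -(Astar.mulVec (D.mulVec u))
      - (Astar * M⁻¹ * Rᵀ * B).mulVec ftil
      + (Astar * M⁻¹ * Rᵀ * B * R).mulVec u) :
    2 * (u ⬝ᵥ ((Aᵀ)⁻¹ * M).mulVec rhs)
        = R.mulVec u ⬝ᵥ B.mulVec (R.mulVec u)
          - 2 * (R.mulVec u ⬝ᵥ B.mulVec ftil)
      ∧ (∀ g : ℝ, ftil 0 = g → ftil 1 = R.mulVec u 1 →
          2 * (u ⬝ᵥ ((Aᵀ)⁻¹ * M).mulVec rhs)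
              = g ^ 2 - (R.mulVec u 1) ^ 2 - (R.mulVec u 0 - g) ^ 2
            ∧ 2 * (u ⬝ᵥ ((Aᵀ)⁻¹ * M).mulVec rhs) ≤ g ^ 2) := by
  have hMu : IsUnit M.det := (Matrix.isUnit_iff_isUnit_det M).1 hMpd.isUnit
  have hAu : IsUnit (Aᵀ).det := by
    rw [Matrix.det_transpose, hA, Matrix.det_diagonal, isUnit_iff_ne_zero]
    exact Finset.prod_ne_zero_iff.2 fun i _ => ha i
  have key : (Aᵀ)⁻¹ * M * Astar = M := by
    rw [hAstar, Matrix.mul_assoc, Matrix.mul_assoc, Matrix.mul_nonsing_inv_cancel_left _ _ hMu,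
      Matrix.nonsing_inv_mul_cancel_left _ _ hAu]
  have key2 : (Aᵀ)⁻¹ * M * (Astar * M⁻¹ * Rᵀ * B) = Rᵀ * B := by
    have : (Aᵀ)⁻¹ * M * (Astar * M⁻¹ * Rᵀ * B)
        = ((Aᵀ)⁻¹ * M * Astar) * M⁻¹ * Rᵀ * B := by
      simp only [Matrix.mul_assoc]
    rw [this, key, Matrix.mul_nonsing_inv _ hMu, Matrix.one_mul]
  have hT : ∀ w : Fin 2 → ℝ, u ⬝ᵥ (Rᵀ * B) *ᵥ w = R *ᵥ u ⬝ᵥ B *ᵥ w := by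
    intro w
    rw [← Matrix.mulVec_mulVec, Matrix.dotProduct_mulVec, Matrix.vecMul_transpose]
  have hD : 2 * (u ⬝ᵥ (M * D) *ᵥ u) = R *ᵥ u ⬝ᵥ B *ᵥ (R *ᵥ u) := by
    have h1 : u ⬝ᵥ (Dᵀ * M) *ᵥ u = u ⬝ᵥ (M * D) *ᵥ u := by
      have : Dᵀ * M = (M * D)ᵀ := by rw [Matrix.transpose_mul, hMsymm.eq]
      rw [this, Matrix.mulVec_transpose, dotProduct_comm, ← Matrix.dotProduct_mulVec]
    have h2 : u ⬝ᵥ (M * D + Dᵀ * M) *ᵥ u = R *ᵥ u ⬝ᵥ B *ᵥ (R *ᵥ u) := by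
      rw [hSBP, ← Matrix.mulVec_mulVec, hT]
    rw [Matrix.add_mulVec, dotProduct_add, h1] at h2
    linarith
  have main : 2 * (u ⬝ᵥ ((Aᵀ)⁻¹ * M).mulVec rhs)
        = R.mulVec u ⬝ᵥ B.mulVec (R.mulVec u)
          - 2 * (R.mulVec u ⬝ᵥ B.mulVec ftil) := by
    rw [hrhs, Matrix.mulVec_add, Matrix.mulVec_sub, Matrix.mulVec_neg, Matrix.mulVec_mulVec,
      Matrix.mulVec_mulVec, Matrix.mulVec_mulVec, key, key2, Matrix.mulVec_mulVec,
      ← Matrix.mul_assoc, key2,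
      ← Matrix.mulVec_mulVec (M := Rᵀ * B), dotProduct_add, dotProduct_sub, dotProduct_neg,
      hT, hT]
    linarith
  refine ⟨main, fun g h0 h1 => ?_⟩
  have e : 2 * (u ⬝ᵥ ((Aᵀ)⁻¹ * M).mulVec rhs)
      = g ^ 2 - (R.mulVec u 1) ^ 2 - (R.mulVec u 0 - g) ^ 2 := by
    rw [main]
    generalize R *ᵥ u = r at *
    subst hB
    simp [dotProduct, Matrix.mulVec, Fin.sum_univ_two, h0, h1]
    ring
  refine ⟨e, ?_⟩
  rw [e]
  nlinarith [sq_nonneg (R.mulVec u 1), sq_nonneg (R.mulVec u 0 - g)]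
end

section
/- Let (D, M, R) be an SBP discretisation on n nodes with D𝟙 = 0 and R𝟙 = (1,1)ᵀ. For u ∈ ℝⁿ let U = diag(u) and U* = M⁻¹ Uᵀ M, and for any numerical-flux vector f ∈ ℝ² define the Burgers right-hand side rhs := −(1/3) U* D u − (1/3) D (u∘u) − M⁻¹ Rᵀ B ( f − (1/3) R(u∘u) − (1/6) (R u)∘(R u) ). Then the discrete mass rate satisfies 𝟙ᵀ M · rhs = −(R𝟙)ᵀ B f = f₀ − f₁, i.e. the semidiscretisation of Burgers' equation is conservative across elements. -/
open Matrix

/-- the general-SBP split-form semidiscretisation of Burgers'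
equation is conservative across elements: with `D 𝟙 = 0` and `R 𝟙 = (1,1)ᵀ`,
`𝟙ᵀ M rhs = −(R𝟙)ᵀ B f = f₀ − f₁`. -/
theorem burgers_conservation_general_SBP
    (n : ℕ) (D M : Matrix (Fin n) (Fin n) ℝ)
    (R : Matrix (Fin 2) (Fin n) ℝ)
    (B : Matrix (Fin 2) (Fin 2) ℝ) (hB : B = !![(-1 : ℝ), 0; 0, 1])
    (hMpd : M.PosDef) (hMsymm : M.IsSymm)
    (hSBP : M * D + Dᵀ * M = Rᵀ * B * R)
    (hD1 : D.mulVec (fun _ => (1 : ℝ)) = 0)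
    (hR1 : R.mulVec (fun _ => (1 : ℝ)) = ![1, 1])
    (u : Fin n → ℝ) (f : Fin 2 → ℝ)
    (U Ustar : Matrix (Fin n) (Fin n) ℝ)
    (hU : U = Matrix.diagonal u) (hUstar : Ustar = M⁻¹ * Uᵀ * M)
    (rhs : Fin n → ℝ)
    (hrhs : rhs = -((1 / 3 : ℝ) • Ustar.mulVec (D.mulVec u))
      - (1 / 3 : ℝ) • D.mulVec (u * u)
      - M⁻¹.mulVec (Rᵀ.mulVec (B.mulVec
          (f - (1 / 3 : ℝ) • R.mulVec (u * u)
             - (1 / 6 : ℝ) • (R.mulVec u * R.mulVec u))))) :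
    (fun _ => (1 : ℝ)) ⬝ᵥ M.mulVec rhs
        = -(R.mulVec (fun _ => (1 : ℝ)) ⬝ᵥ B.mulVec f)
      ∧ (fun _ => (1 : ℝ)) ⬝ᵥ M.mulVec rhs = f 0 - f 1 := by
  have key : ∀ x y : Fin n → ℝ, x ⬝ᵥ M.mulVec (D.mulVec y) + D.mulVec x ⬝ᵥ M.mulVec y
      = R.mulVec x ⬝ᵥ B.mulVec (R.mulVec y) := by
    intro x y
    have h := congrArg (fun A : Matrix (Fin n) (Fin n) ℝ => x ⬝ᵥ A.mulVec y) hSBP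
    simp only [Matrix.add_mulVec, dotProduct_add, ← Matrix.mulVec_mulVec] at h
    rw [Matrix.dotProduct_mulVec x Dᵀ, Matrix.dotProduct_mulVec x Rᵀ,
      Matrix.vecMul_transpose, Matrix.vecMul_transpose] at h
    exact h
  have hdet : IsUnit M.det := (Matrix.isUnit_iff_isUnit_det M).1 hMpd.isUnit
  have hinv : ∀ v : Fin n → ℝ, M.mulVec (M⁻¹.mulVec v) = v := by
    intro v
    rw [Matrix.mulVec_mulVec, Matrix.mul_nonsing_inv M hdet, Matrix.one_mulVec]
  have h1 := key (fun _ => 1) (u * u)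
  rw [hD1, zero_dotProduct, add_zero] at h1
  have h2 := key u u
  have hsym : D.mulVec u ⬝ᵥ M.mulVec u = u ⬝ᵥ M.mulVec (D.mulVec u) := by
    rw [Matrix.dotProduct_mulVec, ← Matrix.mulVec_transpose, hMsymm.eq, dotProduct_comm]
  rw [hsym] at h2
  have h3 : (fun _ => (1 : ℝ)) ⬝ᵥ M.mulVec (Ustar.mulVec (D.mulVec u))
      = u ⬝ᵥ M.mulVec (D.mulVec u) := by
    rw [hUstar, ← Matrix.mulVec_mulVec, ← Matrix.mulVec_mulVec, hinv, hU,
      Matrix.diagonal_transpose]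
    simp [dotProduct, Matrix.mulVec_diagonal]
  have h4 : ∀ w : Fin 2 → ℝ, (fun _ => (1 : ℝ)) ⬝ᵥ Rᵀ.mulVec w = ![1, 1] ⬝ᵥ w := by
    intro w
    rw [Matrix.dotProduct_mulVec, Matrix.vecMul_transpose, hR1]
  have main : (fun _ => (1 : ℝ)) ⬝ᵥ M.mulVec rhs = f 0 - f 1 := by
    rw [hrhs]
    simp only [Matrix.mulVec_sub M, Matrix.mulVec_neg, Matrix.mulVec_smul M, hinv,
      dotProduct_sub, dotProduct_neg, dotProduct_smul, h3, h4, h1, smul_eq_mul]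
    rw [hR1]
    generalize u ⬝ᵥ M.mulVec (D.mulVec u) = e at *
    subst hB
    generalize R.mulVec (u * u) = p at *
    generalize R.mulVec u = q at *
    simp [dotProduct, Matrix.mulVec, Fin.sum_univ_two] at h2 ⊢
    linarith
  refine ⟨?_, main⟩
  rw [main, hR1, hB]
  simp [dotProduct, Matrix.mulVec, Fin.sum_univ_two]
  try ring
end

section
/- Let (D, M, R) be an SBP discretisation on n nodes. For u ∈ ℝⁿ let U = diag(u), U* = M⁻¹ Uᵀ M, and for any numerical-flux vector f ∈ ℝ² define rhs := −(1/3) U* D u − (1/3) D (u∘u) − M⁻¹ Rᵀ B ( f − (1/3) R(u∘u) − (1/6) (R u)∘(R u) ). Then uᵀ M · rhs = −(R u)ᵀ B ( f − (1/6) (R u)∘(R u) ). Consequently, if two neighbouring elements are coupled by a two-point numerical flux f^{num} that is entropy stable for the L² entropy U(u) = u²/2, i.e. (u₊ − u₋) f^{num}(u₋, u₊) ≤ (u₊³ − u₋³)/6 for all u₋, u₊, then the combined contribution of one interior boundary to the total discrete energy rate, (u₊ − u₋) f^{num}(u₋, u₊) − (1/6)(u₊³ − u₋³), is ≤ 0,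 so the semidiscretisation is L² stable across elements. -/
open Matrix

/-- the general-SBP split-form semidiscretisation of Burgers'
equation satisfies `uᵀ M rhs = −(Ru)ᵀ B ( f − (1/6)(Ru)∘(Ru) )`; moreover,
for any two-point numerical flux that is entropy stable for the L² entropy,
i.e. `(u₊ − u₋) f^{num}(u₋,u₊) ≤ (u₊³ − u₋³)/6`, the combined contribution
`(u₊ − u₋) f^{num}(u₋,u₊) − (1/6)(u₊³ − u₋³)` of one interior boundary to the
total discrete energy rate is nonpositive. -/
theorem burgers_energy_rate_general_SBP
    (n : ℕ) (D M : Matrix (Fin n) (Fin n) ℝ)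
    (R : Matrix (Fin 2) (Fin n) ℝ)
    (B : Matrix (Fin 2) (Fin 2) ℝ) (hB : B = !![(-1 : ℝ), 0; 0, 1])
    (hMpd : M.PosDef) (hMsymm : M.IsSymm)
    (hSBP : M * D + Dᵀ * M = Rᵀ * B * R)
    (u : Fin n → ℝ) (f : Fin 2 → ℝ)
    (U Ustar : Matrix (Fin n) (Fin n) ℝ)
    (hU : U = Matrix.diagonal u) (hUstar : Ustar = M⁻¹ * Uᵀ * M)
    (rhs : Fin n → ℝ)
    (hrhs : rhs = -((1 / 3 : ℝ) • Ustar.mulVec (D.mulVec u))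
      - (1 / 3 : ℝ) • D.mulVec (u * u)
      - M⁻¹.mulVec (Rᵀ.mulVec (B.mulVec
          (f - (1 / 3 : ℝ) • R.mulVec (u * u)
             - (1 / 6 : ℝ) • (R.mulVec u * R.mulVec u))))) :
    u ⬝ᵥ M.mulVec rhs
        = -(R.mulVec u ⬝ᵥ B.mulVec
            (f - (1 / 6 : ℝ) • (R.mulVec u * R.mulVec u)))
      ∧ (∀ fnum : ℝ → ℝ → ℝ,
          (∀ um up : ℝ, (up - um) * fnum um up ≤ (up ^ 3 - um ^ 3) / 6) →
          ∀ um up : ℝ,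
            (up - um) * fnum um up - (1 / 6) * (up ^ 3 - um ^ 3) ≤ 0) := by
  refine ⟨?_, fun fnum h um up => by linarith [h um up]⟩
  have hdet : IsUnit M.det := isUnit_iff_ne_zero.mpr hMpd.det_pos.ne'
  have hMM : M * M⁻¹ = 1 := Matrix.mul_nonsing_inv M hdet
  have h1 : u ⬝ᵥ M *ᵥ (Ustar *ᵥ (D *ᵥ u)) = (u * u) ⬝ᵥ M *ᵥ (D *ᵥ u) := by
    have e : M * Ustar = U * M := by
      rw [hUstar, ← Matrix.mul_assoc, ← Matrix.mul_assoc, hMM, Matrix.one_mul, hU,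
        Matrix.diagonal_transpose]
    rw [Matrix.mulVec_mulVec, e, ← Matrix.mulVec_mulVec, hU]
    simp only [dotProduct, Matrix.mulVec_diagonal, Pi.mul_apply, mul_assoc]
  have h2 : u ⬝ᵥ M *ᵥ (D *ᵥ (u * u)) + (u * u) ⬝ᵥ M *ᵥ (D *ᵥ u)
      = (R *ᵥ u) ⬝ᵥ B *ᵥ (R *ᵥ (u * u)) := by
    have e := congrArg (fun A => u ⬝ᵥ A *ᵥ (u * u)) hSBP
    simp only [Matrix.add_mulVec, dotProduct_add, ← Matrix.mulVec_mulVec] at e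
    have t1 : u ⬝ᵥ Dᵀ *ᵥ (M *ᵥ (u * u)) = (u * u) ⬝ᵥ M *ᵥ (D *ᵥ u) := by
      rw [Matrix.dotProduct_mulVec, Matrix.vecMul_transpose, Matrix.dotProduct_mulVec,
        dotProduct_comm, ← Matrix.mulVec_transpose, hMsymm.eq]
    have t2 : u ⬝ᵥ Rᵀ *ᵥ (B *ᵥ (R *ᵥ (u * u))) = (R *ᵥ u) ⬝ᵥ B *ᵥ (R *ᵥ (u * u)) := by
      rw [Matrix.dotProduct_mulVec, Matrix.vecMul_transpose]
    rw [t1, t2] at e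
    exact e
  have h3 : ∀ w : Fin 2 → ℝ, u ⬝ᵥ M *ᵥ (M⁻¹ *ᵥ (Rᵀ *ᵥ w)) = (R *ᵥ u) ⬝ᵥ w := by
    intro w
    rw [Matrix.mulVec_mulVec, hMM, Matrix.one_mulVec, Matrix.dotProduct_mulVec,
      Matrix.vecMul_transpose]
  rw [hrhs]
  rw [Matrix.mulVec_sub, dotProduct_sub, h3]
  simp only [Matrix.mulVec_sub, Matrix.mulVec_neg, Matrix.mulVec_smul, dotProduct_sub,
    dotProduct_neg, dotProduct_smul, smul_eq_mul]
  rw [h1]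
  linarith [h2]
end
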